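/- Let A = ℂ[q, q^{-1}]. Φ_1 restricts to an isomorphism of A-algebras from the A-subalgebra of the Ore localization of 𝒜 at {d^n : n ∈ ℕ} generated by a, b, c, d, d^{-1} onto the A-subalgebra U_A' of U_q generated by (q - q^{-1})E, (q - q^{-1})F, K and K^{-1}. -/

import Mathlib

noncomputable section

abbrev Kq : Type := RatFunc ℂ

/-- The indeterminate `q`. -/
noncomputable def qv : Kq := RatFunc.X

/-- Generators `a`, `b`, `c`, `d` of the algebra `𝒜 = ℒ_{0,1}(sl(2))`. -/
inductive AGen : Type
  | a | b | c | d

/-- The defining relations of `𝒜 = ℒ_{0,1}(sl(2))`. -/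
inductive ARel : FreeAlgebra Kq AGen → FreeAlgebra Kq AGen → Prop
  | ad_comm : ARel (FreeAlgebra.ι Kq AGen.a * FreeAlgebra.ι Kq AGen.d)
      (FreeAlgebra.ι Kq AGen.d * FreeAlgebra.ι Kq AGen.a)
  | db : ARel (FreeAlgebra.ι Kq AGen.d * FreeAlgebra.ι Kq AGen.b)
      ((qv ^ 2) • (FreeAlgebra.ι Kq AGen.b * FreeAlgebra.ι Kq AGen.d))
  | cd : ARel (FreeAlgebra.ι Kq AGen.c * FreeAlgebra.ι Kq AGen.d)
      ((qv ^ 2) • (FreeAlgebra.ι Kq AGen.d * FreeAlgebra.ι Kq AGen.c))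
  | ab : ARel (FreeAlgebra.ι Kq AGen.a * FreeAlgebra.ι Kq AGen.b
        - FreeAlgebra.ι Kq AGen.b * FreeAlgebra.ι Kq AGen.a)
      ((-(1 - qv⁻¹ ^ 2)) • (FreeAlgebra.ι Kq AGen.b * FreeAlgebra.ι Kq AGen.d))
  | cb : ARel (FreeAlgebra.ι Kq AGen.c * FreeAlgebra.ι Kq AGen.b
        - FreeAlgebra.ι Kq AGen.b * FreeAlgebra.ι Kq AGen.c)
      ((1 - qv⁻¹ ^ 2) • (FreeAlgebra.ι Kq AGen.d * FreeAlgebra.ι Kq AGen.a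
        - FreeAlgebra.ι Kq AGen.d * FreeAlgebra.ι Kq AGen.d))
  | ac : ARel (FreeAlgebra.ι Kq AGen.a * FreeAlgebra.ι Kq AGen.c
        - FreeAlgebra.ι Kq AGen.c * FreeAlgebra.ι Kq AGen.a)
      ((1 - qv⁻¹ ^ 2) • (FreeAlgebra.ι Kq AGen.d * FreeAlgebra.ι Kq AGen.c))
  | det : ARel (FreeAlgebra.ι Kq AGen.a * FreeAlgebra.ι Kq AGen.d
        - (qv ^ 2) • (FreeAlgebra.ι Kq AGen.b * FreeAlgebra.ι Kq AGen.c)) 1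

/-- The algebra `𝒜 = ℒ_{0,1}(sl(2))`, presented by generators and relations. -/
abbrev Aalg : Type := RingQuot ARel

noncomputable def aA : Aalg := RingQuot.mkAlgHom Kq ARel (FreeAlgebra.ι Kq AGen.a)
noncomputable def bA : Aalg := RingQuot.mkAlgHom Kq ARel (FreeAlgebra.ι Kq AGen.b)
noncomputable def cA : Aalg := RingQuot.mkAlgHom Kq ARel (FreeAlgebra.ι Kq AGen.c)
noncomputable def dA : Aalg := RingQuot.mkAlgHom Kq ARel (FreeAlgebra.ι Kq AGen.d)

/-- The element `ω = q a + q⁻¹ d`. -/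
noncomputable def ωA : Aalg := qv • aA + qv⁻¹ • dA

/-- Generators `E`, `F`, `K`, `K⁻¹` of the quantum group `U_q(sl(2))`. -/
inductive UGen : Type
  | E | F | K | Kinv

/-- The defining relations of `U_q(sl(2))`. -/
inductive URel : FreeAlgebra Kq UGen → FreeAlgebra Kq UGen → Prop
  | KKinv : URel (FreeAlgebra.ι Kq UGen.K * FreeAlgebra.ι Kq UGen.Kinv) 1
  | KinvK : URel (FreeAlgebra.ι Kq UGen.Kinv * FreeAlgebra.ι Kq UGen.K) 1
  | KE : URel (FreeAlgebra.ι Kq UGen.K * FreeAlgebra.ι Kq UGen.E * FreeAlgebra.ι Kq UGen.Kinv)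
      ((qv ^ 2) • FreeAlgebra.ι Kq UGen.E)
  | KF : URel (FreeAlgebra.ι Kq UGen.K * FreeAlgebra.ι Kq UGen.F * FreeAlgebra.ι Kq UGen.Kinv)
      ((qv⁻¹ ^ 2) • FreeAlgebra.ι Kq UGen.F)
  | EF : URel (FreeAlgebra.ι Kq UGen.E * FreeAlgebra.ι Kq UGen.F
        - FreeAlgebra.ι Kq UGen.F * FreeAlgebra.ι Kq UGen.E)
      (((qv - qv⁻¹)⁻¹) • (FreeAlgebra.ι Kq UGen.K - FreeAlgebra.ι Kq UGen.Kinv))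

/-- The quantum group `U_q = U_q(sl(2))`, presented by generators and relations. -/
abbrev Uq : Type := RingQuot URel

noncomputable def Eel : Uq := RingQuot.mkAlgHom Kq URel (FreeAlgebra.ι Kq UGen.E)
noncomputable def Fel : Uq := RingQuot.mkAlgHom Kq URel (FreeAlgebra.ι Kq UGen.F)
noncomputable def Kel : Uq := RingQuot.mkAlgHom Kq URel (FreeAlgebra.ι Kq UGen.K)
noncomputable def Kinvel : Uq := RingQuot.mkAlgHom Kq URel (FreeAlgebra.ι Kq UGen.Kinv)

/-- The ring `A = ℂ[q, q⁻¹]`, as a subalgebra of `ℂ(q)`. -/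
noncomputable def Asub : Subalgebra ℂ Kq := Algebra.adjoin ℂ {qv, qv⁻¹}

noncomputable instance : Algebra (↥Asub) Uq :=
  RingHom.toAlgebra' ((algebraMap Kq Uq).comp (algebraMap (↥Asub) Kq))
    (fun c x => Algebra.commutes (algebraMap (↥Asub) Kq c) x)

open Polynomial

section Relations

lemma qv_ne_zero : qv ≠ 0 := RatFunc.X_ne_zero

lemma qv_zpow_injective : Function.Injective fun n : ℤ => qv ^ n := by
  intro m n h
  have h' := congrArg RatFunc.intDegree h
  have key : ∀ k : ℤ, (qv ^ k).intDegree = k := by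
    have hn : ∀ k : ℕ, (qv ^ k).intDegree = k := by
      intro k
      have : qv ^ k = algebraMap ℂ[X] Kq (X ^ k) := by
        rw [map_pow, RatFunc.algebraMap_X]; rfl
      rw [this, RatFunc.intDegree_polynomial, natDegree_X_pow]
    intro k
    obtain ⟨k, rfl | rfl⟩ := k.eq_nat_or_neg
    · rw [zpow_natCast, hn]
    · rw [zpow_neg, zpow_natCast, RatFunc.intDegree_inv, hn]
  simpa only [key] using h'

lemma qv_sub_inv_ne_zero : qv - qv⁻¹ ≠ 0 := by
  intro h
  have h1 : (fun n : ℤ => qv ^ n) 1 = (fun n : ℤ => qv ^ n) (-1) := by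
    simpa using sub_eq_zero.mp h
  have := qv_zpow_injective h1
  omega

lemma aA_mul_dA : aA * dA = dA * aA := by
  simpa [aA, dA] using RingQuot.mkAlgHom_rel Kq ARel.ad_comm

lemma dA_mul_bA : dA * bA = (qv ^ 2) • (bA * dA) := by
  simpa [bA, dA] using RingQuot.mkAlgHom_rel Kq ARel.db

lemma cA_mul_dA : cA * dA = (qv ^ 2) • (dA * cA) := by
  simpa [cA, dA] using RingQuot.mkAlgHom_rel Kq ARel.cd

lemma aA_bA_commutator : aA * bA - bA * aA = (-(1 - qv⁻¹ ^ 2)) • (bA * dA) := by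
  simpa only [aA, bA, dA, map_sub, map_mul, map_smul] using
    RingQuot.mkAlgHom_rel Kq ARel.ab

lemma cA_bA_commutator : cA * bA - bA * cA = (1 - qv⁻¹ ^ 2) • (dA * aA - dA * dA) := by
  simpa only [aA, bA, cA, dA, map_sub, map_mul, map_smul] using
    RingQuot.mkAlgHom_rel Kq ARel.cb

lemma aA_cA_commutator : aA * cA - cA * aA = (1 - qv⁻¹ ^ 2) • (dA * cA) := by
  simpa only [aA, cA, dA, map_sub, map_mul, map_smul] using
    RingQuot.mkAlgHom_rel Kq ARel.ac

lemma aA_dA_sub_bA_cA : aA * dA - (qv ^ 2) • (bA * cA) = 1 := by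
  simpa only [aA, bA, cA, dA, map_sub, map_mul, map_smul, map_one] using
    RingQuot.mkAlgHom_rel Kq ARel.det

lemma Kel_mul_Kinvel : Kel * Kinvel = 1 := by
  simpa only [Kel, Kinvel, map_mul, map_one] using
    RingQuot.mkAlgHom_rel Kq URel.KKinv

lemma Kinvel_mul_Kel : Kinvel * Kel = 1 := by
  simpa only [Kel, Kinvel, map_mul, map_one] using
    RingQuot.mkAlgHom_rel Kq URel.KinvK

lemma ωA_commute_bA : Commute ωA bA := by
  have h1 : aA * bA = bA * aA + (-(1 - qv⁻¹ ^ 2)) • (bA * dA) := by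
    rw [← aA_bA_commutator]; abel
  have hq := qv_ne_zero
  rw [Commute, SemiconjBy, ωA, add_mul, mul_add, smul_mul_assoc, smul_mul_assoc, h1, dA_mul_bA,
    mul_smul_comm, mul_smul_comm, smul_add, add_assoc, smul_smul, smul_smul, ← add_smul]
  congr 2
  field_simp
  ring

lemma ωA_commute_cA : Commute ωA cA := by
  have h1 : aA * cA = cA * aA + (1 - qv⁻¹ ^ 2) • (dA * cA) := by
    rw [← aA_cA_commutator]; abel
  have hq := qv_ne_zero
  rw [Commute, SemiconjBy, ωA, add_mul, mul_add, smul_mul_assoc, smul_mul_assoc, h1,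
    mul_smul_comm, mul_smul_comm, cA_mul_dA, smul_add, add_assoc, smul_smul, smul_smul, ← add_smul]
  congr 2
  field_simp
  ring

lemma ωA_commute_dA : Commute ωA dA := by
  rw [Commute, SemiconjBy, ωA, add_mul, mul_add, smul_mul_assoc, smul_mul_assoc, aA_mul_dA,
    mul_smul_comm, mul_smul_comm]

lemma aA_eq : aA = qv⁻¹ • ωA - (qv⁻¹ ^ 2) • dA := by
  have hq := qv_ne_zero
  rw [ωA, smul_add, smul_smul, smul_smul, inv_mul_cancel₀ hq, one_smul, pow_two,
    add_sub_cancel_right]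

end Relations

section SpanningSet

lemma commute_aeval_ωA {x : Aalg} (h : Commute ωA x) (p : Kq[X]) : Commute (aeval ωA p) x := by
  induction p using Polynomial.induction_on' with
  | add p r hp hr => rw [map_add]; exact hp.add_left hr
  | monomial n c =>
    rw [aeval_monomial]
    exact Commute.mul_left (Algebra.commutes c x) (h.pow_left n)

/-- The homomorphism from polynomials in two commuting variables to `𝒜` given by `ω` and `d`. -/
def polyOmegaD : Kq[X][X] →+* Aalg :=
  eval₂RingHom' (aeval ωA : Kq[X] →ₐ[Kq] Aalg).toRingHom dA
    (commute_aeval_ωA ωA_commute_dA)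

lemma polyOmegaD_X : polyOmegaD X = dA := eval₂_X _ _

lemma polyOmegaD_C (p : Kq[X]) : polyOmegaD (C p) = aeval ωA p := eval₂_C _ _

lemma polyOmegaD_C_C (s : Kq) : polyOmegaD (C (C s)) = algebraMap Kq Aalg s := by
  rw [polyOmegaD_C, aeval_C]

lemma polyOmegaD_C_X : polyOmegaD (C X) = ωA := by
  rw [polyOmegaD_C, aeval_X]

lemma polyOmegaD_smul (s : Kq) (r : Kq[X][X]) :
    polyOmegaD (C (C s) * r) = s • polyOmegaD r := by
  rw [map_mul, polyOmegaD_C_C, Algebra.smul_def]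

lemma exists_polyOmegaD_swap {x : Aalg} (hω : Commute ωA x) {s : Kq}
    (hd : x * dA = s • (dA * x)) (r : Kq[X][X]) :
    ∃ r', x * polyOmegaD r = polyOmegaD r' * x := by
  induction r using Polynomial.induction_on with
  | C p => exact ⟨C p, by rw [polyOmegaD_C]; exact (commute_aeval_ωA hω p).eq.symm⟩
  | add r₁ r₂ h₁ h₂ =>
    obtain ⟨r₁', h₁⟩ := h₁
    obtain ⟨r₂', h₂⟩ := h₂
    exact ⟨r₁' + r₂', by rw [map_add, map_add, mul_add, add_mul, h₁, h₂]⟩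
  | monomial n p h =>
    obtain ⟨r', h⟩ := h
    refine ⟨C (C s) * (r' * X), ?_⟩
    rw [pow_succ, ← mul_assoc, map_mul, ← mul_assoc, h, mul_assoc, polyOmegaD_X, hd,
      polyOmegaD_smul, map_mul, polyOmegaD_X, mul_smul_comm, smul_mul_assoc, mul_assoc]

lemma bA_mul_dA : bA * dA = (qv⁻¹ ^ 2) • (dA * bA) := by
  have hq := qv_ne_zero
  rw [dA_mul_bA, smul_smul, ← mul_pow, inv_mul_cancel₀ hq, one_pow, one_smul]

lemma exists_bA_mul_cA : ∃ r, bA * cA = polyOmegaD r := by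
  refine ⟨C (C (qv⁻¹ ^ 2)) * ((C (C qv⁻¹) * C X - C (C (qv⁻¹ ^ 2)) * X) * X - 1), ?_⟩
  have hq := qv_ne_zero
  rw [polyOmegaD_smul, map_sub, map_mul, map_sub, polyOmegaD_smul, polyOmegaD_smul, polyOmegaD_X,
    polyOmegaD_C_X, map_one, ← aA_eq, ← aA_dA_sub_bA_cA, sub_sub_cancel, smul_smul, ← mul_pow,
    inv_mul_cancel₀ hq, one_pow, one_smul]

lemma exists_polyOmegaD_eq_aA : ∃ r, aA = polyOmegaD r := by
  refine ⟨C (C qv⁻¹) * C X - C (C (qv⁻¹ ^ 2)) * X, ?_⟩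
  rw [map_sub, polyOmegaD_smul, polyOmegaD_smul, polyOmegaD_X, polyOmegaD_C_X, ← aA_eq]

lemma exists_cA_mul_bA : ∃ r, cA * bA = polyOmegaD r := by
  obtain ⟨r, hr⟩ := exists_bA_mul_cA
  obtain ⟨s, hs⟩ := exists_polyOmegaD_eq_aA
  refine ⟨r + C (C (1 - qv⁻¹ ^ 2)) * (X * s - X * X), ?_⟩
  rw [map_add, polyOmegaD_smul, map_sub, map_mul, map_mul, polyOmegaD_X, ← hs, ← hr,
    ← cA_bA_commutator]
  abel

/-- The elements `b ^ n` for `n ≥ 0` and `c ^ (-n)` for `n ≤ 0`. -/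
def weightElt (n : ℤ) : Aalg := bA ^ n.toNat * cA ^ (-n).toNat

lemma weightElt_natCast (i : ℕ) : weightElt i = bA ^ i := by simp [weightElt]

lemma weightElt_neg_natCast (i : ℕ) : weightElt (-i) = cA ^ i := by simp [weightElt]

lemma exists_bA_mul_weightElt (n : ℤ) :
    ∃ r, bA * weightElt n = polyOmegaD r * weightElt (n + 1) := by
  obtain ⟨i, rfl | rfl⟩ := n.eq_nat_or_neg
  · refine ⟨1, ?_⟩
    rw [weightElt_natCast, ← Nat.cast_succ, weightElt_natCast, map_one, one_mul, pow_succ']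
  · cases i with
    | zero => exact ⟨1, by simp [weightElt]⟩
    | succ i =>
      obtain ⟨r, hr⟩ := exists_bA_mul_cA
      refine ⟨r, ?_⟩
      have : -((i + 1 : ℕ) : ℤ) + 1 = -(i : ℤ) := by push_cast; ring
      rw [this, weightElt_neg_natCast, weightElt_neg_natCast, pow_succ', ← mul_assoc, hr]

lemma exists_cA_mul_weightElt (n : ℤ) :
    ∃ r, cA * weightElt n = polyOmegaD r * weightElt (n - 1) := by
  obtain ⟨i, rfl | rfl⟩ := n.eq_nat_or_neg
  · cases i with
    | zero => exact ⟨1, by simp [weightElt]⟩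
    | succ i =>
      obtain ⟨r, hr⟩ := exists_cA_mul_bA
      refine ⟨r, ?_⟩
      have : ((i + 1 : ℕ) : ℤ) - 1 = i := by push_cast; ring
      rw [this, weightElt_natCast, weightElt_natCast, pow_succ', ← mul_assoc, hr]
  · refine ⟨1, ?_⟩
    have : -(i : ℤ) - 1 = -((i + 1 : ℕ) : ℤ) := by push_cast; ring
    rw [this, weightElt_neg_natCast, weightElt_neg_natCast, map_one, one_mul, pow_succ']

/-- The map sending a family `(rₙ)` to `∑ rₙ(ω, d) eₙ` where `eₙ` is `weightElt n`. -/
def weightSum : (ℤ →₀ Kq[X][X]) →+ Aalg :=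
  Finsupp.liftAddHom fun n => (AddMonoidHom.mulRight (weightElt n)).comp polyOmegaD.toAddMonoidHom

lemma weightSum_apply (f : ℤ →₀ Kq[X][X]) :
    weightSum f = f.sum fun n r => polyOmegaD r * weightElt n := rfl

lemma polyOmegaD_mul_weightElt_mem (r : Kq[X][X]) (n : ℤ) :
    polyOmegaD r * weightElt n ∈ AddMonoidHom.mrange weightSum :=
  ⟨Finsupp.single n r, by rw [weightSum_apply, Finsupp.sum_single_index (by simp)]⟩

lemma mul_mem_range_weightSum {x : Aalg}
    (h : ∀ r n, x * (polyOmegaD r * weightElt n) ∈ AddMonoidHom.mrange weightSum) {y : Aalg}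
    (hy : y ∈ AddMonoidHom.mrange weightSum) : x * y ∈ AddMonoidHom.mrange weightSum := by
  obtain ⟨f, rfl⟩ := hy
  rw [weightSum_apply, Finsupp.sum, Finset.mul_sum]
  exact sum_mem fun n _ => h _ _

lemma polyOmegaD_mul_mem_range (r : Kq[X][X]) {y : Aalg} (hy : y ∈ AddMonoidHom.mrange weightSum) :
    polyOmegaD r * y ∈ AddMonoidHom.mrange weightSum :=
  mul_mem_range_weightSum (fun s n => by
    rw [← mul_assoc, ← map_mul]; exact polyOmegaD_mul_weightElt_mem _ _) hy

lemma swap_mul_mem_range {x : Aalg} (hx : ∀ r, ∃ r', x * polyOmegaD r = polyOmegaD r' * x)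
    (hw : ∀ n, ∃ r m, x * weightElt n = polyOmegaD r * weightElt m) {y : Aalg}
    (hy : y ∈ AddMonoidHom.mrange weightSum) : x * y ∈ AddMonoidHom.mrange weightSum := by
  refine mul_mem_range_weightSum (fun r n => ?_) hy
  obtain ⟨r', hr'⟩ := hx r
  obtain ⟨s, m, hs⟩ := hw n
  rw [← mul_assoc, hr', mul_assoc, hs, ← mul_assoc, ← map_mul]
  exact polyOmegaD_mul_weightElt_mem _ _

lemma weightSum_surjective : Function.Surjective weightSum := by
  have key : ∀ x : FreeAlgebra Kq AGen, ∀ y ∈ AddMonoidHom.mrange weightSum,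
      RingQuot.mkAlgHom Kq ARel x * y ∈ AddMonoidHom.mrange weightSum := by
    intro x
    induction x using FreeAlgebra.induction with
    | grade0 s =>
      intro y hy
      rw [AlgHom.commutes, ← polyOmegaD_C_C]
      exact polyOmegaD_mul_mem_range _ hy
    | grade1 g =>
      intro y hy
      cases g with
      | a =>
        obtain ⟨r, hr⟩ := exists_polyOmegaD_eq_aA
        change aA * y ∈ _
        rw [hr]
        exact polyOmegaD_mul_mem_range _ hy
      | b =>
        exact swap_mul_mem_range (exists_polyOmegaD_swap ωA_commute_bA bA_mul_dA)
          (fun n => (exists_bA_mul_weightElt n).imp fun _ h => ⟨_, h⟩) hy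
      | c =>
        exact swap_mul_mem_range (exists_polyOmegaD_swap ωA_commute_cA cA_mul_dA)
          (fun n => (exists_cA_mul_weightElt n).imp fun _ h => ⟨_, h⟩) hy
      | d =>
        change dA * y ∈ _
        rw [← polyOmegaD_X]
        exact polyOmegaD_mul_mem_range _ hy
    | mul x₁ x₂ h₁ h₂ =>
      intro y hy
      rw [map_mul, mul_assoc]
      exact h₁ _ (h₂ _ hy)
    | add x₁ x₂ h₁ h₂ =>
      intro y hy
      rw [map_add, add_mul]
      exact add_mem (h₁ _ hy) (h₂ _ hy)
  intro x
  obtain ⟨x, rfl⟩ := RingQuot.mkAlgHom_surjective Kq ARel x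
  have h1 : (1 : Aalg) ∈ AddMonoidHom.mrange weightSum := by
    simpa [weightElt] using polyOmegaD_mul_weightElt_mem 1 0
  simpa using key x 1 h1

end SpanningSet

section WeightModule

/-- The coefficient of `E` on the weight module. -/
def raiseCoeff (m : ℤ) : Kq[X] :=
  C (((qv - qv⁻¹) ^ 2)⁻¹) * (X - C (qv * qv ^ (-2 * m) + qv⁻¹ * qv ^ (2 * m)))

lemma raiseCoeff_ne_zero (m : ℤ) : raiseCoeff m ≠ 0 :=
  mul_ne_zero (C_ne_zero.mpr (inv_ne_zero (pow_ne_zero _ qv_sub_inv_ne_zero))) (X_sub_C_ne_zero _)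

/-- The operator of `E` on the weight module. -/
def opE : Module.End Kq (ℤ → Kq[X]) where
  toFun f m := raiseCoeff (m + 1) * f (m + 1)
  map_add' f g := by ext1 m; simp [mul_add]
  map_smul' s f := by ext1 m; simp

/-- The operator of `F` on the weight module. -/
def opF : Module.End Kq (ℤ → Kq[X]) where
  toFun f m := f (m - 1)
  map_add' _ _ := rfl
  map_smul' _ _ := rfl

/-- The operator of `K` on the weight module. -/
def opK : Module.End Kq (ℤ → Kq[X]) where
  toFun f m := qv ^ (-2 * m) • f m
  map_add' f g := by ext1 m; simp
  map_smul' s f := by ext1 m; simp [smul_comm s]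

/-- The operator of `K⁻¹` on the weight module. -/
def opKinv : Module.End Kq (ℤ → Kq[X]) where
  toFun f m := qv ^ (2 * m) • f m
  map_add' f g := by ext1 m; simp
  map_smul' s f := by ext1 m; simp [smul_comm s]

lemma opE_apply (f : ℤ → Kq[X]) (m : ℤ) : opE f m = raiseCoeff (m + 1) * f (m + 1) := rfl

lemma opF_apply (f : ℤ → Kq[X]) (m : ℤ) : opF f m = f (m - 1) := rfl

lemma opK_apply (f : ℤ → Kq[X]) (m : ℤ) : opK f m = qv ^ (-2 * m) • f m := rfl

lemma opKinv_apply (f : ℤ → Kq[X]) (m : ℤ) : opKinv f m = qv ^ (2 * m) • f m := rfl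

/-- The images of the generators of `U_q` on the weight module. -/
def opGen : UGen → Module.End Kq (ℤ → Kq[X])
  | .E => opE
  | .F => opF
  | .K => opK
  | .Kinv => opKinv

lemma raiseCoeff_succ_sub (m : ℤ) :
    raiseCoeff (m + 1) - raiseCoeff m =
      C ((qv - qv⁻¹)⁻¹ * (qv ^ (-2 * m) - qv ^ (2 * m))) := by
  have hq := qv_ne_zero
  have ht := qv_sub_inv_ne_zero
  rw [raiseCoeff, raiseCoeff, ← mul_sub, sub_sub_sub_cancel_left, ← C_sub, ← C_mul]
  congr 1
  have e1 : qv ^ (-2 * (m + 1)) = qv ^ (-2 * m) * qv⁻¹ ^ 2 := by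
    rw [mul_add, zpow_add₀ hq]; norm_num [zpow_neg]
  have e2 : qv ^ (2 * (m + 1)) = qv ^ (2 * m) * qv ^ 2 := by
    rw [mul_add, zpow_add₀ hq]; norm_num
  rw [e1, e2]
  generalize qv ^ (-2 * m) = u
  generalize qv ^ (2 * m) = v
  rw [inv_mul_eq_iff_eq_mul₀ (pow_ne_zero _ ht), pow_two (qv - qv⁻¹), mul_assoc,
    mul_inv_cancel_left₀ ht]
  field_simp
  ring

lemma opGen_rel {x y : FreeAlgebra Kq UGen} (h : URel x y) :
    FreeAlgebra.lift Kq opGen x = FreeAlgebra.lift Kq opGen y := by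
  have hq := qv_ne_zero
  have huv : ∀ m : ℤ, qv ^ (-2 * m) * qv ^ (2 * m) = 1 := fun m => by
    rw [← zpow_add₀ hq]; simp
  cases h <;>
    simp only [map_mul, map_sub, map_smul, map_one, FreeAlgebra.lift_ι_apply, opGen] <;>
    refine LinearMap.ext fun f => funext fun m => ?_
  · simp only [Module.End.mul_apply, Module.End.one_apply, opK_apply, opKinv_apply, smul_smul,
      huv, one_smul]
  · simp only [Module.End.mul_apply, Module.End.one_apply, opK_apply, opKinv_apply, smul_smul,
      mul_comm (qv ^ (2 * m)), huv, one_smul]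
  · simp only [Module.End.mul_apply, LinearMap.smul_apply, Pi.smul_apply, opK_apply, opKinv_apply,
      opE_apply, mul_smul_comm, smul_smul]
    congr 1
    rw [← zpow_add₀ hq, ← zpow_natCast]
    congr 1
    push_cast
    ring
  · simp only [Module.End.mul_apply, LinearMap.smul_apply, Pi.smul_apply, opK_apply, opKinv_apply,
      opF_apply, smul_smul]
    congr 1
    rw [← zpow_add₀ hq, inv_pow, ← zpow_natCast, ← zpow_neg]
    congr 1
    push_cast
    ring
  · simp only [Module.End.mul_apply, LinearMap.smul_apply, LinearMap.sub_apply, Pi.smul_apply,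
      Pi.sub_apply, opK_apply, opKinv_apply, opF_apply, opE_apply, add_sub_cancel_right,
      sub_add_cancel]
    rw [← sub_mul, raiseCoeff_succ_sub, ← sub_smul, smul_smul, ← smul_eq_C_mul]

/-- A representation of `U_q` on functions `ℤ → ℂ(q)[X]` on which the Casimir element acts
through the indeterminate `X`. -/
def weightRep : Uq →ₐ[Kq] Module.End Kq (ℤ → Kq[X]) :=
  RingQuot.liftAlgHom Kq ⟨FreeAlgebra.lift Kq opGen, fun _ _ h => opGen_rel h⟩

lemma weightRep_Eel : weightRep Eel = opE := by
  simp [weightRep, Eel, RingQuot.liftAlgHom_mkAlgHom_apply, opGen]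

lemma weightRep_Fel : weightRep Fel = opF := by
  simp [weightRep, Fel, RingQuot.liftAlgHom_mkAlgHom_apply, opGen]

lemma weightRep_Kel : weightRep Kel = opK := by
  simp [weightRep, Kel, RingQuot.liftAlgHom_mkAlgHom_apply, opGen]

lemma weightRep_Kinvel : weightRep Kinvel = opKinv := by
  simp [weightRep, Kinvel, RingQuot.liftAlgHom_mkAlgHom_apply, opGen]

end WeightModule

section Injectivity

variable {π : Aalg →ₐ[Kq] Module.End Kq (ℤ → Kq[X])}

lemma polyOmegaD_action (hω : ∀ f m, π ωA f m = X * f m) (hd : π dA = opKinv)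
    (r : Kq[X][X]) (f : ℤ → Kq[X]) (m : ℤ) :
    π (polyOmegaD r) f m = r.eval (C (qv ^ (2 * m))) * f m := by
  have hp : ∀ (p : Kq[X]) (f : ℤ → Kq[X]), π (aeval ωA p) f m = p * f m := by
    intro p
    induction p using Polynomial.induction_on with
    | C s =>
      intro f
      rw [aeval_C, AlgHom.commutes, Module.algebraMap_end_apply, Pi.smul_apply, smul_eq_C_mul]
    | add p₁ p₂ h₁ h₂ =>
      intro f
      rw [map_add, map_add, LinearMap.add_apply, Pi.add_apply, h₁, h₂, add_mul]
    | monomial n s h =>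
      intro f
      rw [pow_succ, ← mul_assoc, map_mul, map_mul, Module.End.mul_apply, h, aeval_X, hω, ← mul_assoc]
  induction r using Polynomial.induction_on generalizing f with
  | C p => rw [polyOmegaD_C, hp, eval_C]
  | add r₁ r₂ h₁ h₂ =>
    rw [map_add, map_add, LinearMap.add_apply, Pi.add_apply, h₁, h₂, eval_add, add_mul]
  | monomial n p h =>
    rw [pow_succ, ← mul_assoc, map_mul, map_mul, Module.End.mul_apply, h, polyOmegaD_X, hd,
      opKinv_apply, eval_mul_X, smul_eq_C_mul, mul_assoc]

lemma exists_pow_single {T : Module.End Kq (ℤ → Kq[X])} {k : ℤ}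
    (hT : ∀ m, ∃ γ : Kq[X], γ ≠ 0 ∧ ∀ p, T (Pi.single m p) = Pi.single (m + k) (γ * p))
    (n : ℕ) (m : ℤ) :
    ∃ γ : Kq[X], γ ≠ 0 ∧ ∀ p, (T ^ n) (Pi.single m p) = Pi.single (m + n * k) (γ * p) := by
  induction n with
  | zero => exact ⟨1, one_ne_zero, fun p => by simp⟩
  | succ n ih =>
    obtain ⟨γ, hγ, h⟩ := ih
    obtain ⟨δ, hδ, h'⟩ := hT (m + n * k)
    refine ⟨δ * γ, mul_ne_zero hδ hγ, fun p => ?_⟩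
    rw [pow_succ', Module.End.mul_apply, h, h', mul_assoc]
    congr 1
    push_cast
    ring

lemma opF_single (m : ℤ) (p : Kq[X]) : opF (Pi.single m p) = Pi.single (m + 1) p := by
  ext1 k
  rw [opF_apply, Pi.single_apply, Pi.single_apply]
  simp only [sub_eq_iff_eq_add]

lemma opE_single (m : ℤ) (p : Kq[X]) :
    opE (Pi.single m p) = Pi.single (m - 1) (raiseCoeff m * p) := by
  ext1 k
  rw [opE_apply, Pi.single_apply, Pi.single_apply]
  simp only [eq_sub_iff_add_eq]
  split_ifs with h
  · rw [h]
  · rw [mul_zero]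

lemma opKinv_single (m : ℤ) (p : Kq[X]) :
    opKinv (Pi.single m p) = Pi.single m (C (qv ^ (2 * m)) * p) := by
  ext1 k
  rw [opKinv_apply, Pi.single_apply, Pi.single_apply]
  split_ifs with h
  · rw [h, smul_eq_C_mul]
  · rw [smul_zero]

lemma exists_weightElt_single {s t : Kq} (hs : s ≠ 0) (ht : t ≠ 0) (hb : π bA = s • opF)
    (hc : π cA = t • (opKinv * opE)) (n m : ℤ) :
    ∃ γ : Kq[X], γ ≠ 0 ∧ π (weightElt n) (Pi.single m 1) = Pi.single (m + n) γ := by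
  obtain ⟨i, rfl | rfl⟩ := n.eq_nat_or_neg
  · obtain ⟨γ, hγ, h⟩ := exists_pow_single (T := π bA) (k := 1)
      (fun m => ⟨C s, C_ne_zero.mpr hs, fun p => by
        rw [hb, LinearMap.smul_apply, opF_single, ← Pi.single_smul, smul_eq_C_mul]⟩) i m
    exact ⟨γ, hγ, by rw [weightElt_natCast, map_pow, h, mul_one, mul_one]⟩
  · obtain ⟨γ, hγ, h⟩ := exists_pow_single (T := π cA) (k := -1)
      (fun m => ⟨C t * (C (qv ^ (2 * (m - 1))) * raiseCoeff m),
        mul_ne_zero (C_ne_zero.mpr ht) (mul_ne_zero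
          (C_ne_zero.mpr (zpow_ne_zero _ qv_ne_zero)) (raiseCoeff_ne_zero m)), fun p => by
        rw [hc, LinearMap.smul_apply, Module.End.mul_apply, opE_single, opKinv_single,
          ← Pi.single_smul, smul_eq_C_mul, mul_assoc, mul_assoc, sub_eq_add_neg]⟩) i m
    exact ⟨γ, hγ, by rw [weightElt_neg_natCast, map_pow, h, mul_one, mul_neg_one]⟩

lemma eq_zero_of_eval_zpow_eq_zero {r : Kq[X][X]}
    (h : ∀ m : ℤ, r.eval (C (qv ^ (2 * m))) = 0) : r = 0 := by
  refine eq_zero_of_infinite_isRoot r (Set.Infinite.mono (Set.range_subset_iff.mpr h)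
    (Set.infinite_range_of_injective fun m n hmn => ?_))
  have := qv_zpow_injective (C_injective hmn)
  omega

lemma injective_of_weight_action {s t : Kq} (hs : s ≠ 0) (ht : t ≠ 0)
    (hω : ∀ f m, π ωA f m = X * f m) (hb : π bA = s • opF)
    (hc : π cA = t • (opKinv * opE)) (hd : π dA = opKinv) : Function.Injective π := by
  rw [injective_iff_map_eq_zero]
  intro x hx
  obtain ⟨f, rfl⟩ := weightSum_surjective x
  suffices f = 0 by rw [this, map_zero]
  ext1 n
  refine eq_zero_of_eval_zpow_eq_zero fun k => ?_
  choose γ hγ hγ' using fun n m => exists_weightElt_single hs ht hb hc n m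
  have h : π (weightSum f) (Pi.single (k - n) 1) k = 0 := by rw [hx]; rfl
  rw [weightSum_apply, Finsupp.sum, map_sum, LinearMap.sum_apply, Finset.sum_apply,
    Finset.sum_eq_single n] at h
  · rw [map_mul, Module.End.mul_apply, polyOmegaD_action hω hd, hγ', sub_add_cancel,
      Pi.single_eq_same] at h
    exact (mul_eq_zero.mp h).resolve_right (hγ _ _)
  · intro l _ hl
    rw [map_mul, Module.End.mul_apply, polyOmegaD_action hω hd, hγ', Pi.single_eq_of_ne, mul_zero]
    omega
  · intro hn
    rw [Finsupp.notMem_support_iff.mp hn, map_zero, zero_mul, map_zero]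
    rfl

end Injectivity

lemma smul_mem_adjoin_Asub {S : Set Uq} {s : Kq} (hs : s ∈ Asub) {x : Uq}
    (hx : x ∈ Algebra.adjoin (↥Asub) S) : s • x ∈ Algebra.adjoin (↥Asub) S := by
  rw [Algebra.smul_def]
  exact mul_mem (Subalgebra.algebraMap_mem (Algebra.adjoin (↥Asub) S) (⟨s, hs⟩ : ↥Asub)) hx

/-- `Φ₁` restricts to an isomorphism of `A`-algebras from the `A`-subalgebra of the Ore
localization of `𝒜` at the powers of `d` generated by `a, b, c, d, d⁻¹` onto the
`A`-subalgebra `U_A'` of `U_q` generated by `(q - q⁻¹)E`, `(q - q⁻¹)F`, `K` and `K⁻¹`.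
Since the extension of `Φ₁` to the localization sends `d⁻¹` to `K`, this is expressed by:
`Φ₁` is injective, `Φ₁(d) K = K Φ₁(d) = 1`, and the `A`-subalgebra of `U_q` generated by
`Φ₁(a), Φ₁(b), Φ₁(c), Φ₁(d), K` (the image of `⟨a,b,c,d,d⁻¹⟩_A`) equals `U_A'`. -/
theorem statement6 (Φ : Aalg →ₐ[Kq] Uq)
    (hΦa : Φ aA = Kel + (qv⁻¹ * (qv - qv⁻¹) ^ 2) • (Fel * Eel))
    (hΦb : Φ bA = (qv⁻¹ * (qv - qv⁻¹)) • Fel)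
    (hΦc : Φ cA = (qv - qv⁻¹) • (Kinvel * Eel))
    (hΦd : Φ dA = Kinvel) :
    Function.Injective Φ
    ∧ Φ dA * Kel = 1 ∧ Kel * Φ dA = 1
    ∧ Algebra.adjoin (↥Asub) ({Φ aA, Φ bA, Φ cA, Φ dA, Kel} : Set Uq)
      = Algebra.adjoin (↥Asub)
          ({(qv - qv⁻¹) • Eel, (qv - qv⁻¹) • Fel, Kel, Kinvel} : Set Uq) := by
  have hq := qv_ne_zero
  have ht := qv_sub_inv_ne_zero
  refine ⟨?_, by rw [hΦd, Kinvel_mul_Kel], by rw [hΦd, Kel_mul_Kinvel], ?_⟩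
  · have hd : (weightRep.comp Φ) dA = opKinv := by
      rw [AlgHom.comp_apply, hΦd, weightRep_Kinvel]
    have hinj : Function.Injective (weightRep.comp Φ) := by
      refine injective_of_weight_action (s := qv⁻¹ * (qv - qv⁻¹)) (t := qv - qv⁻¹)
        (mul_ne_zero (inv_ne_zero hq) ht) ht (fun f m => ?_) ?_ ?_ hd
      · have ha : (weightRep.comp Φ) aA
            = opK + (qv⁻¹ * (qv - qv⁻¹) ^ 2) • (opF * opE) := by
          rw [AlgHom.comp_apply, hΦa, map_add, map_smul, map_mul, weightRep_Kel, weightRep_Fel,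
            weightRep_Eel]
        rw [ωA, map_add, map_smul, map_smul, ha, hd]
        simp only [LinearMap.add_apply, LinearMap.smul_apply, Pi.add_apply, Pi.smul_apply,
          Module.End.mul_apply, opK_apply, opKinv_apply, opF_apply, opE_apply, sub_add_cancel]
        have hcoeff : qv * (qv⁻¹ * (qv - qv⁻¹) ^ 2) * ((qv - qv⁻¹) ^ 2)⁻¹ = 1 := by
          rw [mul_inv_cancel_left₀ hq, mul_inv_cancel₀ (pow_ne_zero _ ht)]
        have hraise : C (qv * (qv⁻¹ * (qv - qv⁻¹) ^ 2)) * raiseCoeff m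
            = X - C (qv * qv ^ (-2 * m) + qv⁻¹ * qv ^ (2 * m)) := by
          rw [raiseCoeff, ← mul_assoc, ← C_mul, hcoeff, C_1, one_mul]
        rw [smul_add, smul_smul, smul_smul, smul_smul, smul_eq_C_mul, smul_eq_C_mul,
          smul_eq_C_mul, ← mul_assoc (C _) (raiseCoeff m), hraise, C_add]
        ring
      · rw [AlgHom.comp_apply, hΦb, map_smul, weightRep_Fel]
      · rw [AlgHom.comp_apply, hΦc, map_smul, map_mul, weightRep_Kinvel, weightRep_Eel]
    exact Function.Injective.of_comp (f := weightRep) hinj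
  · have hqm : qv ∈ Asub := Algebra.subset_adjoin (by simp)
    have hqi : qv⁻¹ ∈ Asub := Algebra.subset_adjoin (by simp)
    apply le_antisymm
    · set S : Set Uq := {(qv - qv⁻¹) • Eel, (qv - qv⁻¹) • Fel, Kel, Kinvel} with hS
      have hE : (qv - qv⁻¹) • Eel ∈ Algebra.adjoin (↥Asub) S :=
        Algebra.subset_adjoin (by simp [hS])
      have hF : (qv - qv⁻¹) • Fel ∈ Algebra.adjoin (↥Asub) S :=
        Algebra.subset_adjoin (by simp [hS])
      have hK : Kel ∈ Algebra.adjoin (↥Asub) S := Algebra.subset_adjoin (by simp [hS])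
      have hKi : Kinvel ∈ Algebra.adjoin (↥Asub) S := Algebra.subset_adjoin (by simp [hS])
      refine Algebra.adjoin_le ?_
      rintro x (rfl | rfl | rfl | rfl | rfl)
      · have h := add_mem hK (smul_mem_adjoin_Asub hqi (mul_mem hF hE))
        rwa [smul_mul_smul_comm, smul_smul, ← pow_two, ← hΦa] at h
      · have h := smul_mem_adjoin_Asub hqi hF
        rwa [smul_smul, ← hΦb] at h
      · have h := mul_mem hKi hE
        rwa [mul_smul_comm, ← hΦc] at h
      · rwa [hΦd]
      · exact hK
    · set S : Set Uq := {Φ aA, Φ bA, Φ cA, Φ dA, Kel} with hS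
      have hb : Φ bA ∈ Algebra.adjoin (↥Asub) S := Algebra.subset_adjoin (by simp [hS])
      have hc : Φ cA ∈ Algebra.adjoin (↥Asub) S := Algebra.subset_adjoin (by simp [hS])
      have hd : Φ dA ∈ Algebra.adjoin (↥Asub) S := Algebra.subset_adjoin (by simp [hS])
      have hK : Kel ∈ Algebra.adjoin (↥Asub) S := Algebra.subset_adjoin (by simp [hS])
      refine Algebra.adjoin_le ?_
      rintro x (rfl | rfl | rfl | rfl)
      · have h := mul_mem hK hc
        rwa [hΦc, mul_smul_comm, ← mul_assoc, Kel_mul_Kinvel, one_mul] at h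
      · have h := smul_mem_adjoin_Asub hqm hb
        rwa [hΦb, smul_smul, mul_inv_cancel_left₀ hq] at h
      · exact hK
      · rwa [hΦd] at hd
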